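/- arXiv:1804.03168 — 2 statements merged into one kernel-verified Lean document; each statement's English description precedes it below -/
import Mathlib

section
/- Let ζ = e^{2πi/3} and let q ∈ ℂ with 1 + 27q ≠ 0. A point (w₀, w₁, w₂, w₃) ∈ ℂ⁴ satisfies the system w₀·w₁·w₂ = q·w₃³ and w_i + w₃/3 + ζ^i = 0 for i = 0, 1, 2, if and only if there exists L ∈ ℂ with L³·(1+27q) = 1 such that w₃ = -3L and w_i = L - ζ^i for i = 0, 1, 2. -/
noncomputable section

/-- `ζ = e^{2πi/3}`. -/
def zeta3 : ℂ := Complex.exp (2 * Real.pi * Complex.I / 3)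

theorem zeta3_isPrimitiveRoot : IsPrimitiveRoot zeta3 3 :=
  Complex.isPrimitiveRoot_exp 3 (by norm_num)

theorem one_add_zeta3_add_sq : 1 + zeta3 + zeta3 ^ 2 = 0 := by
  simpa [Finset.sum_range_succ] using zeta3_isPrimitiveRoot.geom_sum_eq_zero (by norm_num)

theorem sub_one_mul_sub_zeta3_mul_sub_sq (L : ℂ) :
    (L - 1) * (L - zeta3) * (L - zeta3 ^ 2) = L ^ 3 - 1 := by
  linear_combination (-L ^ 2 + L * zeta3 - (zeta3 - 1)) * one_add_zeta3_add_sq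

/-- Classification of the critical points of Givental's equivariant mirror of
local ℙ²: `(w₀,w₁,w₂,w₃)` satisfies `w₀w₁w₂ = q·w₃³` and `wᵢ + w₃/3 + ζ^i = 0`
for `i = 0,1,2` iff there is an `L` with `L³(1+27q) = 1`, `w₃ = -3L`, and
`wᵢ = L - ζ^i`. -/
theorem mirror_critical_points (q w0 w1 w2 w3 : ℂ) (hq : 1 + 27 * q ≠ 0) :
    (w0 * w1 * w2 = q * w3 ^ 3 ∧
      w0 + w3 / 3 + 1 = 0 ∧ w1 + w3 / 3 + zeta3 = 0 ∧ w2 + w3 / 3 + zeta3 ^ 2 = 0) ↔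
    ∃ L : ℂ, L ^ 3 * (1 + 27 * q) = 1 ∧
      w3 = -3 * L ∧ w0 = L - 1 ∧ w1 = L - zeta3 ∧ w2 = L - zeta3 ^ 2 := by
  constructor
  · rintro ⟨h, h0, h1, h2⟩
    obtain ⟨L, rfl⟩ : ∃ L : ℂ, w3 = -3 * L := ⟨-w3 / 3, by ring⟩
    obtain rfl : w0 = L - 1 := by linear_combination h0
    obtain rfl : w1 = L - zeta3 := by linear_combination h1
    obtain rfl : w2 = L - zeta3 ^ 2 := by linear_combination h2
    exact ⟨L, by linear_combination h - sub_one_mul_sub_zeta3_mul_sub_sq L, rfl, rfl, rfl, rfl⟩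
  · rintro ⟨L, h, rfl, rfl, rfl, rfl⟩
    refine ⟨?_, by ring, by ring, by ring⟩
    linear_combination h + sub_one_mul_sub_zeta3_mul_sub_sq L

end
end

section
/- Let V be the free module over ℚ[[θ]] with basis φ₀, φ₁, φ₂, and for each integer i ≥ 0 let K_i be the finite set of rationals k with 0 ≤ k < i/3, 3k ∈ ℤ, and k ≡ i/3 modulo ℤ. Consider the formal sum I(θ, z) = Σ_{i≥0} (θ^i/(i!·z^i))·∏_{k∈K_i}(1 - k³z³)·φ_{i mod 3}, a well-defined element of V[[θ]] extended by formal powers of z. Then I contains no positive powers of z; its z⁰-coefficient is φ₀; its z^{-1}-coefficient equals I₁(θ)·φ₁ where I₁(θ) = Σ_{n≥0} (-1)ⁿ·θ^{3n+1}/(3n+1)!·∏_{j=0}^{n-1}(j+1/3)³; and its z^{-2}-coefficient equals I₂(θ)·φ₂ where I₂(θ) = Σ_{n≥0} (-1)ⁿ·θ^{3n+2}/(3n+2)!·∏_{j=0}^{n-1}(j+2/3)³. -/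
open PowerSeries

noncomputable section

/-- `I₁(θ) = Σ_{n≥0} (-1)ⁿ·θ^{3n+1}/(3n+1)!·∏_{j=0}^{n-1}(j+1/3)³ ∈ ℚ[[θ]]`. -/
def I1ser : PowerSeries ℚ :=
  PowerSeries.mk fun m =>
    if m % 3 = 1 then
      (-1 : ℚ) ^ (m / 3) / m.factorial * ∏ j ∈ Finset.range (m / 3), ((j : ℚ) + 1/3) ^ 3
    else 0

/-- `I₂(θ) = Σ_{n≥0} (-1)ⁿ·θ^{3n+2}/(3n+2)!·∏_{j=0}^{n-1}(j+2/3)³ ∈ ℚ[[θ]]`. -/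
def I2ser : PowerSeries ℚ :=
  PowerSeries.mk fun m =>
    if m % 3 = 2 then
      (-1 : ℚ) ^ (m / 3) / m.factorial * ∏ j ∈ Finset.range (m / 3), ((j : ℚ) + 2/3) ^ 3
    else 0

/-- The polynomial `∏_{k ∈ K_i} (1 - k³z³)` in the variable `z`, where
`K_i = {k : 0 ≤ k < i/3, 3k ∈ ℤ, k ≡ i/3 (mod ℤ)}`; writing `k = j/3` with
`j ∈ {0,…,i-1}`, `j ≡ i (mod 3)`, it is `∏_j (1 - (j/3)³·z³)`. -/
def prodPoly (i : ℕ) : Polynomial ℚ :=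
  ∏ j ∈ (Finset.range i).filter (fun j => j % 3 = i % 3),
    (1 - Polynomial.C (((j : ℚ) / 3) ^ 3) * Polynomial.X ^ 3)

/-- The coefficient of `z^w` (for `w : ℤ`) in the small `I`-function
`I(θ,z) = Σ_{i≥0} (θ^i/(i!·z^i))·∏_{k∈K_i}(1-k³z³)·φ_{i mod 3}`, as a vector of
formal power series in `θ` in the basis `φ₀, φ₁, φ₂` (the component `a` collects
the terms with `i ≡ a (mod 3)`). -/
def Izcoeff (w : ℤ) : Fin 3 → PowerSeries ℚ := fun a =>
  PowerSeries.mk fun i =>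
    if (a : ℕ) = i % 3 ∧ 0 ≤ w + (i : ℤ) then
      (prodPoly i).coeff (w + (i : ℤ)).toNat / i.factorial
    else 0

/-- Reindexing `K_i` by `j = 3m + (i mod 3)` exhibits `prodPoly i` as a polynomial in `z³`. -/
theorem prodPoly_eq_expand (i : ℕ) :
    prodPoly i = Polynomial.expand ℚ 3
      (∏ m ∈ Finset.range (i / 3),
        (1 - Polynomial.C (((m : ℚ) + (i % 3 : ℕ) / 3) ^ 3) * Polynomial.X)) := by
  rw [prodPoly, map_prod]
  refine Finset.prod_nbij' (fun j => j / 3) (fun m => 3 * m + i % 3) ?_ ?_ ?_ ?_ ?_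
  · intro j hj
    simp only [Finset.mem_filter, Finset.mem_range] at hj ⊢
    omega
  · intro m hm
    simp only [Finset.mem_filter, Finset.mem_range] at hm ⊢
    omega
  · intro j hj
    simp only [Finset.mem_filter, Finset.mem_range] at hj ⊢
    omega
  · intro m hm
    simp only [Finset.mem_range] at hm ⊢
    omega
  · intro j hj
    simp only [Finset.mem_filter, Finset.mem_range] at hj
    have h : (j : ℚ) = 3 * (j / 3 : ℕ) + (i % 3 : ℕ) := by
      exact_mod_cast (by omega : j = 3 * (j / 3) + i % 3)
    have h' : (j : ℚ) / 3 = (j / 3 : ℕ) + (i % 3 : ℕ) / 3 := by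
      rw [h]
      ring
    rw [h']
    simp only [map_sub, map_one, map_mul, Polynomial.expand_C, Polynomial.expand_X]

theorem natDegree_one_sub_C_mul_X_le (c : ℚ) :
    (1 - Polynomial.C c * Polynomial.X).natDegree ≤ 1 := by
  compute_degree

theorem prodPoly_coeff_of_not_dvd {i k : ℕ} (h : ¬ 3 ∣ k) : (prodPoly i).coeff k = 0 := by
  rw [prodPoly_eq_expand, Polynomial.coeff_expand (by norm_num), if_neg h]

theorem prodPoly_coeff_of_lt {i k : ℕ} (h : 3 * (i / 3) < k) : (prodPoly i).coeff k = 0 := by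
  apply Polynomial.coeff_eq_zero_of_natDegree_lt
  refine lt_of_le_of_lt ?_ h
  rw [prodPoly_eq_expand, Polynomial.natDegree_expand, mul_comm]
  refine Nat.mul_le_mul_left 3 ((Polynomial.natDegree_prod_le _ _).trans ?_)
  refine (Finset.sum_le_sum fun m _ => natDegree_one_sub_C_mul_X_le _).trans ?_
  rw [Finset.sum_const, Finset.card_range, smul_eq_mul, mul_one]

theorem prodPoly_coeff_top (i : ℕ) :
    (prodPoly i).coeff (3 * (i / 3)) =
      (-1) ^ (i / 3) * ∏ m ∈ Finset.range (i / 3), ((m : ℚ) + (i % 3 : ℕ) / 3) ^ 3 := by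
  rw [prodPoly_eq_expand, Polynomial.coeff_expand_mul' (by norm_num)]
  have h := Polynomial.coeff_prod_of_natDegree_le (Finset.range (i / 3))
    (fun m : ℕ => 1 - Polynomial.C (((m : ℚ) + (i % 3 : ℕ) / 3) ^ 3) * Polynomial.X) 1
    fun m _ => natDegree_one_sub_C_mul_X_le _
  rw [Finset.card_range, mul_one] at h
  rw [h]
  simp only [Polynomial.coeff_sub, Polynomial.coeff_C_mul, Polynomial.coeff_X_one,
    Polynomial.coeff_one, one_ne_zero, if_false, zero_sub, mul_one]
  rw [Finset.prod_neg, Finset.card_range]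

/-- For `w = -a` with `0 ≤ a ≤ 2`, only the top coefficients of the `φ_a`-terms survive. -/
theorem coeff_Izcoeff_neg (w : ℕ) (hw : w < 3) (a : Fin 3) (i : ℕ) :
    PowerSeries.coeff i (Izcoeff (-(w : ℤ)) a) =
      if (a : ℕ) = w ∧ i % 3 = w then
        (-1 : ℚ) ^ (i / 3) / i.factorial *
          ∏ m ∈ Finset.range (i / 3), ((m : ℚ) + (w : ℚ) / 3) ^ 3
      else 0 := by
  rw [Izcoeff, PowerSeries.coeff_mk]
  by_cases h : (a : ℕ) = i % 3 ∧ 0 ≤ -(w : ℤ) + (i : ℤ)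
  · rw [if_pos h]
    by_cases hi : i % 3 = w
    · have hk : (-(w : ℤ) + (i : ℤ)).toNat = 3 * (i / 3) := by omega
      rw [if_pos ⟨h.1.trans hi, hi⟩, hk, prodPoly_coeff_top, hi]
      ring
    · rw [if_neg fun h' => hi h'.2]
      rcases lt_or_gt_of_ne hi with hlt | hgt
      · rw [prodPoly_coeff_of_not_dvd (by omega), zero_div]
      · rw [prodPoly_coeff_of_lt (by omega), zero_div]
  · rw [if_neg h, if_neg (by omega)]

/-- The small `I`-function of `[ℂ³/ℤ₃]` contains no positive powers of `z`, its
`z⁰`-coefficient is `φ₀`, its `z^{-1}`-coefficient is `I₁(θ)·φ₁`, and its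
`z^{-2}`-coefficient is `I₂(θ)·φ₂`. -/
theorem I_function_expansion :
    (∀ w : ℤ, 0 < w → Izcoeff w = fun _ => 0) ∧
    (Izcoeff 0 = fun a => if a = 0 then 1 else 0) ∧
    (Izcoeff (-1) = fun a => if a = 1 then I1ser else 0) ∧
    (Izcoeff (-2) = fun a => if a = 2 then I2ser else 0) := by
  refine ⟨fun w hw => ?_, ?_, ?_, ?_⟩
  · funext a
    ext i
    rw [Izcoeff, PowerSeries.coeff_mk, prodPoly_coeff_of_lt (by omega)]
    simp
  · funext a
    ext i
    have h := coeff_Izcoeff_neg 0 (by norm_num) a i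
    rw [Nat.cast_zero, neg_zero] at h
    rw [h]
    rcases Nat.eq_zero_or_pos i with rfl | hi
    · fin_cases a <;> simp
    · have hz : (if a = 0 then 1 else 0 : PowerSeries ℚ).coeff i = 0 := by
        split_ifs <;> simp [PowerSeries.coeff_one, hi.ne']
      rw [hz, ite_eq_right_iff]
      rintro ⟨-, h3⟩
      rw [Finset.prod_eq_zero (Finset.mem_range.2 (by omega : 0 < i / 3)) (by simp), mul_zero]
  · funext a
    ext i
    refine (coeff_Izcoeff_neg 1 (by norm_num) a i).trans ?_
    fin_cases a <;> simp [I1ser]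
  · funext a
    ext i
    refine (coeff_Izcoeff_neg 2 (by norm_num) a i).trans ?_
    fin_cases a <;> simp [I2ser]

end
end
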